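/- arXiv:math/0607650 — 2 statements merged into one kernel-verified Lean document; each statement's English description precedes it below -/
import Mathlib

section
/- Let a be a positive real number and let z, ν be complex numbers with 0 < Re(z) < Re(ν). Then the integral ∫₀^∞ x^{z-1} (x + a + (x² + 2ax)^{1/2})^{-ν} dx converges and equals 2 ν a^{-ν} (a/2)^{z} Γ(2z) Γ(ν - z) / Γ(1 + ν + z). -/
open MeasureTheory Set

/-- The substitution `x = (a/2) (1 - t)² / t` maps `(0, 1)` bijectively onto `(0, ∞)`; here its
derivative. -/
lemma hasDerivAt_mul_one_sub_sq_div (c : ℝ) {t : ℝ} (ht : 0 < t) :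
    HasDerivAt (fun t : ℝ => c * ((1 - t) ^ 2 / t)) (-(c * ((1 - t) * (1 + t) / t ^ 2))) t := by
  have h := (((((hasDerivAt_id t).const_sub 1).pow 2).div (hasDerivAt_id t) ht.ne').const_mul c)
  refine h.congr_deriv ?_
  simp only [id, Pi.pow_apply]
  field_simp
  ring

lemma injOn_mul_one_sub_sq_div {c : ℝ} (hc : 0 < c) :
    InjOn (fun t : ℝ => c * ((1 - t) ^ 2 / t)) (Ioo 0 1) := by
  intro s hs t ht h
  have h' := mul_left_cancel₀ hc.ne' h
  rw [div_eq_div_iff hs.1.ne' ht.1.ne'] at h'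
  have hst : (s - t) * (1 - s * t) = 0 := by linear_combination -h'
  have : s * t < 1 := mul_lt_one_of_nonneg_of_lt_one_left hs.1.le hs.2 ht.2.le
  rcases mul_eq_zero.mp hst with h0 | h0 <;> linarith

/-- Under `x = (a/2) (1 - t)² / t`, the base `x + a + √(x² + 2ax)` becomes `a / t`. -/
lemma add_sqrt_mul_one_sub_sq_div {a t : ℝ} (ha : 0 < a) (ht : t ∈ Ioo (0 : ℝ) 1) :
    a / 2 * ((1 - t) ^ 2 / t) + a +
      Real.sqrt ((a / 2 * ((1 - t) ^ 2 / t)) ^ 2 + 2 * a * (a / 2 * ((1 - t) ^ 2 / t))) =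
      a / t := by
  obtain ⟨h0, h1⟩ := ht
  have h : (a / 2 * ((1 - t) ^ 2 / t)) ^ 2 + 2 * a * (a / 2 * ((1 - t) ^ 2 / t)) =
      (a / 2 * ((1 - t) * (1 + t) / t)) ^ 2 := by
    field_simp
    ring
  have hn : 0 ≤ a / 2 * ((1 - t) * (1 + t) / t) := by
    have : 0 < 1 - t := by linarith
    positivity
  rw [h, Real.sqrt_sq hn]
  field_simp
  ring

lemma image_mul_one_sub_sq_div {a : ℝ} (ha : 0 < a) :
    (fun t : ℝ => a / 2 * ((1 - t) ^ 2 / t)) '' Ioo 0 1 = Ioi 0 := by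
  ext x
  simp only [mem_image, mem_Ioi]
  constructor
  · rintro ⟨t, ⟨h0, h1⟩, rfl⟩
    have : 0 < 1 - t := by linarith
    positivity
  · intro hx
    set s := Real.sqrt (x ^ 2 + 2 * a * x)
    have hs : s ^ 2 = x ^ 2 + 2 * a * x := Real.sq_sqrt (by positivity)
    have hs0 : 0 ≤ s := Real.sqrt_nonneg _
    have hp : 0 < x + a + s := by positivity
    refine ⟨a / (x + a + s), ⟨by positivity, (div_lt_one hp).2 (by linarith)⟩, ?_⟩
    field_simp
    linear_combination hs

/-- The integrand after the substitution is a sum of two Beta integrands. -/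
lemma abs_deriv_smul_integrand_eq {a t : ℝ} (ha : 0 < a) (ht : t ∈ Ioo (0 : ℝ) 1) (z ν : ℂ) :
    |-(a / 2 * ((1 - t) * (1 + t) / t ^ 2))| •
      (((a / 2 * ((1 - t) ^ 2 / t) : ℝ) : ℂ) ^ (z - 1) * ((a / t : ℝ) : ℂ) ^ (-ν)) =
    (a : ℂ) ^ (-ν) * ((a : ℂ) / 2) ^ z *
      ((t : ℂ) ^ (ν - z - 1) * (1 - (t : ℂ)) ^ (2 * z - 1) +
        (t : ℂ) ^ (ν - z + 1 - 1) * (1 - (t : ℂ)) ^ (2 * z - 1)) := by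
  obtain ⟨h0, h1⟩ := ht
  have h1' : 0 < 1 - t := by linarith
  have key (r : ℝ) (hr : 0 < r) (w : ℂ) : (r : ℂ) ^ w = Complex.exp (Real.log r * w) := by
    rw [Complex.cpow_def_of_ne_zero (by exact_mod_cast hr.ne'), Complex.ofReal_log hr.le]
  have hlog : Real.log (a / 2 * ((1 - t) ^ 2 / t)) =
      Real.log (a / 2) + 2 * Real.log (1 - t) - Real.log t := by
    rw [Real.log_mul (by positivity) (by positivity), Real.log_div (by positivity) h0.ne',
      Real.log_pow]
    push_cast
    ring
  have hjac : |-(a / 2 * ((1 - t) * (1 + t) / t ^ 2))| =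
      Real.exp (Real.log (a / 2) + Real.log (1 - t) - 2 * Real.log t) * (1 + t) := by
    rw [abs_neg, abs_of_pos (by positivity), Real.exp_sub, Real.exp_add, two_mul, Real.exp_add,
      Real.exp_log (by positivity), Real.exp_log h1', Real.exp_log h0]
    field_simp
  have ht1 : (t : ℂ) ^ (ν - z + 1 - 1) = (t : ℂ) * (t : ℂ) ^ (ν - z - 1) := by
    rw [show ν - z + 1 - 1 = 1 + (ν - z - 1) by ring,
      Complex.cpow_add _ _ (by exact_mod_cast h0.ne'), Complex.cpow_one]
  have hsub : (1 : ℂ) - t = ((1 - t : ℝ) : ℂ) := by push_cast; ring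
  have hhalf : (a : ℂ) / 2 = ((a / 2 : ℝ) : ℂ) := by push_cast; ring
  rw [ht1, hsub, hhalf, hjac, key _ (by positivity), key _ (by positivity), key _ ha,
    key _ (by positivity), key _ h0, key _ h1', hlog, Real.log_div ha.ne' h0.ne', Complex.real_smul]
  push_cast
  have hexp : ∀ A B C D E F J u : ℂ, J + A + B = C + D + (E + F) →
      Complex.exp J * (1 + u) * (Complex.exp A * Complex.exp B) =
        Complex.exp C * Complex.exp D *
          (Complex.exp E * Complex.exp F + u * Complex.exp E * Complex.exp F) := by
    intro A B C D E F J u h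
    have h' := congrArg Complex.exp h
    simp only [Complex.exp_add] at h'
    linear_combination (1 + u) * h'
  apply hexp
  ring

/-- The integral `∫₀^∞ x^{z-1} (x + a + √(x² + 2ax))^{-ν} dx` converges and equals
`2 ν a^{-ν} (a/2)^z Γ(2z) Γ(ν - z) / Γ(1 + ν + z)` for `0 < Re z < Re ν`. -/
theorem garg_mittal_basic_integral (a : ℝ) (ha : 0 < a) (z ν : ℂ)
    (hz : 0 < z.re) (hzν : z.re < ν.re) :
    IntegrableOn
      (fun x : ℝ => (x : ℂ) ^ (z - 1) *
        ((x + a + Real.sqrt (x ^ 2 + 2 * a * x) : ℝ) : ℂ) ^ (-ν)) (Ioi 0) ∧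
    ∫ x in Ioi (0 : ℝ), (x : ℂ) ^ (z - 1) *
        ((x + a + Real.sqrt (x ^ 2 + 2 * a * x) : ℝ) : ℂ) ^ (-ν)
      = 2 * ν * (a : ℂ) ^ (-ν) * ((a : ℂ) / 2) ^ z * Complex.Gamma (2 * z) *
          Complex.Gamma (ν - z) / Complex.Gamma (1 + ν + z) := by
  have hu : 0 < (ν - z).re := by simpa using hzν
  have hu' : 0 < (ν - z + 1).re := by
    rw [Complex.add_re, Complex.one_re]
    linarith
  have hv : 0 < (2 * z).re := by simpa using hz
  have hc : 0 < a / 2 := by positivity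
  have hderiv : ∀ t ∈ Ioo (0 : ℝ) 1, HasDerivWithinAt (fun t : ℝ => a / 2 * ((1 - t) ^ 2 / t))
      (-(a / 2 * ((1 - t) * (1 + t) / t ^ 2))) (Ioo 0 1) t :=
    fun t ht => (hasDerivAt_mul_one_sub_sq_div _ ht.1).hasDerivWithinAt
  have hcongr : EqOn (fun t : ℝ => |-(a / 2 * ((1 - t) * (1 + t) / t ^ 2))| •
      (((a / 2 * ((1 - t) ^ 2 / t) : ℝ) : ℂ) ^ (z - 1) *
        ((a / 2 * ((1 - t) ^ 2 / t) + a + Real.sqrt ((a / 2 * ((1 - t) ^ 2 / t)) ^ 2 +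
          2 * a * (a / 2 * ((1 - t) ^ 2 / t))) : ℝ) : ℂ) ^ (-ν)))
      (fun t : ℝ => (a : ℂ) ^ (-ν) * ((a : ℂ) / 2) ^ z *
        ((t : ℂ) ^ (ν - z - 1) * (1 - (t : ℂ)) ^ (2 * z - 1) +
          (t : ℂ) ^ (ν - z + 1 - 1) * (1 - (t : ℂ)) ^ (2 * z - 1))) (Ioo 0 1) := by
    intro t ht
    simp only [add_sqrt_mul_one_sub_sq_div ha ht]
    exact abs_deriv_smul_integrand_eq ha ht z ν
  have hb1 := (intervalIntegrable_iff_integrableOn_Ioo_of_le zero_le_one).1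
    (Complex.betaIntegral_convergent hu hv)
  have hb2 := (intervalIntegrable_iff_integrableOn_Ioo_of_le zero_le_one).1
    (Complex.betaIntegral_convergent hu' hv)
  rw [← image_mul_one_sub_sq_div ha]
  constructor
  · rw [integrableOn_image_iff_integrableOn_abs_deriv_smul measurableSet_Ioo hderiv
      (injOn_mul_one_sub_sq_div hc), integrableOn_congr_fun hcongr measurableSet_Ioo]
    exact (hb1.add hb2).const_mul _
  · rw [integral_image_eq_integral_abs_deriv_smul measurableSet_Ioo hderiv
      (injOn_mul_one_sub_sq_div hc), setIntegral_congr_fun measurableSet_Ioo hcongr,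
      integral_const_mul, integral_add hb1 hb2, ← integral_Ioc_eq_integral_Ioo,
      ← integral_Ioc_eq_integral_Ioo, ← intervalIntegral.integral_of_le zero_le_one,
      ← intervalIntegral.integral_of_le zero_le_one]
    have h1 := Complex.betaIntegral_eq_Gamma_mul_div _ _ hu hv
    have h2 := Complex.betaIntegral_eq_Gamma_mul_div _ _ hu' hv
    rw [Complex.betaIntegral] at h1 h2
    have hne : ν - z ≠ 0 := fun h => by simp [h] at hu
    have hpos : 0 < (ν + z).re := by
      rw [Complex.add_re]
      linarith
    have hne' : ν + z ≠ 0 := fun h => by simp [h] at hpos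
    rw [h1, h2, show ν - z + 2 * z = ν + z by ring, show ν - z + 1 + 2 * z = ν + z + 1 by ring,
      show 1 + ν + z = ν + z + 1 by ring, Complex.Gamma_add_one _ hne, Complex.Gamma_add_one _ hne']
    have := Complex.Gamma_ne_zero_of_re_pos hpos
    field_simp
    ring
end

section
/- Let a be a positive real number, let λ, ν be complex numbers with 0 < Re(λ) < Re(ν), let N be a natural number, let α be a positive real number, and let c₀, c₁, …, c_N be arbitrary complex numbers. Write w(x) = x + a + (x² + 2ax)^{1/2}. Then ∫₀^∞ x^{λ-1} w(x)^{-ν} (∑_{K=0}^{N} c_K · w(x)^{-αK}) dx = 2 (a/2)^{λ} Γ(2λ) ∑_{K=0}^{N} c_K a^{-ν-αK} (ν + αK) Γ(ν + αK - λ) / Γ(ν + αK + λ + 1). -/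
open MeasureTheory Set Finset

/-- The substitution `x = a (1 - t)² / (2 t)`, under which
`x + a + √(x² + 2 a x) = a / t` for `0 < t < 1`. -/
noncomputable def radicalSubst (a t : ℝ) : ℝ := a * (1 - t) ^ 2 / (2 * t)

lemma radicalSubst_pos {a t : ℝ} (ha : 0 < a) (ht : t ∈ Ioo (0 : ℝ) 1) :
    0 < radicalSubst a t := by
  have h0 := ht.1
  have h1 : 0 < 1 - t := sub_pos.2 ht.2
  unfold radicalSubst
  positivity

lemma sqrt_radicalSubst {a t : ℝ} (ha : 0 < a) (ht : t ∈ Ioo (0 : ℝ) 1) :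
    √(radicalSubst a t ^ 2 + 2 * a * radicalSubst a t) = a * (1 - t ^ 2) / (2 * t) := by
  have h0 := ht.1
  have h1 : 0 ≤ 1 - t ^ 2 := by nlinarith [ht.1, ht.2]
  rw [show radicalSubst a t ^ 2 + 2 * a * radicalSubst a t = (a * (1 - t ^ 2) / (2 * t)) ^ 2 by
    unfold radicalSubst; field_simp; ring]
  exact Real.sqrt_sq (by positivity)

lemma radicalSubst_add_add_sqrt {a t : ℝ} (ha : 0 < a) (ht : t ∈ Ioo (0 : ℝ) 1) :
    radicalSubst a t + a + √(radicalSubst a t ^ 2 + 2 * a * radicalSubst a t) = a / t := by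
  have h0 := ht.1
  rw [sqrt_radicalSubst ha ht]
  unfold radicalSubst
  field_simp
  ring

lemma injOn_radicalSubst {a : ℝ} (ha : 0 < a) : InjOn (radicalSubst a) (Ioo 0 1) := by
  intro s hs t ht hst
  have h := radicalSubst_add_add_sqrt ha hs
  rw [hst, radicalSubst_add_add_sqrt ha ht] at h
  have h0 := hs.1
  have h1 := ht.1
  field_simp at h
  exact h

lemma image_radicalSubst {a : ℝ} (ha : 0 < a) : radicalSubst a '' Ioo 0 1 = Set.Ioi 0 := by
  ext x
  constructor
  · rintro ⟨t, ht, rfl⟩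
    exact radicalSubst_pos ha ht
  · intro hx
    have hx : 0 < x := hx
    have hr : 0 ≤ √(x ^ 2 + 2 * a * x) := Real.sqrt_nonneg _
    have hr2 : √(x ^ 2 + 2 * a * x) ^ 2 = x ^ 2 + 2 * a * x := Real.sq_sqrt (by positivity)
    set r := √(x ^ 2 + 2 * a * x)
    have hw : 0 < x + a + r := by positivity
    refine ⟨a / (x + a + r), ⟨by positivity, ?_⟩, ?_⟩
    · rw [div_lt_one hw]
      linarith
    · unfold radicalSubst
      field_simp
      linear_combination hr2

lemma hasDerivAt_radicalSubst (a : ℝ) {t : ℝ} (ht : t ≠ 0) :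
    HasDerivAt (radicalSubst a) (-(a / 2 * (1 - t) * (1 + t) / t ^ 2)) t := by
  have h := ((((hasDerivAt_id t).const_sub 1).pow 2).const_mul a).div
    ((hasDerivAt_id t).const_mul 2) (by simpa using ht)
  refine h.congr_deriv ?_
  simp only [id, Pi.pow_apply]
  field_simp
  ring

lemma Complex.ofReal_cpow_eq_exp {x : ℝ} (hx : 0 < x) (s : ℂ) :
    (x : ℂ) ^ s = Complex.exp (Real.log x * s) := by
  rw [Complex.cpow_def_of_ne_zero (by exact_mod_cast hx.ne'), Complex.ofReal_log hx.le]

lemma radicalSubst_integrand {a t : ℝ} (ha : 0 < a) (ht : t ∈ Ioo (0 : ℝ) 1) (lam μ : ℂ) :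
    |-(a / 2 * (1 - t) * (1 + t) / t ^ 2)| • ((radicalSubst a t : ℂ) ^ (lam - 1) *
        ((radicalSubst a t + a +
          √(radicalSubst a t ^ 2 + 2 * a * radicalSubst a t) : ℝ) : ℂ) ^ (-μ))
      = ((a : ℂ) / 2) ^ lam * (a : ℂ) ^ (-μ) *
        ((t : ℂ) ^ (μ - lam - 1) * (1 - (t : ℂ)) ^ (2 * lam - 1) +
          (t : ℂ) ^ (μ - lam + 1 - 1) * (1 - (t : ℂ)) ^ (2 * lam - 1)) := by
  have h0 := ht.1
  have h1 : 0 < 1 - t := sub_pos.2 ht.2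
  have ha2 : 0 < a / 2 := half_pos ha
  rw [radicalSubst_add_add_sqrt ha ht, abs_neg, abs_of_pos (by positivity), Complex.real_smul,
    show (a : ℂ) / 2 = ((a / 2 : ℝ) : ℂ) by push_cast; rfl,
    show 1 - (t : ℂ) = ((1 - t : ℝ) : ℂ) by push_cast; rfl,
    show a / 2 * (1 - t) * (1 + t) / t ^ 2 =
      Real.exp (Real.log (a / 2) + Real.log (1 - t) - 2 * Real.log t) * (1 + t) by
      rw [Real.exp_sub, Real.exp_add, Real.exp_log ha2, Real.exp_log h1, two_mul, Real.exp_add,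
        Real.exp_log h0]
      field_simp,
    show μ - lam + 1 - 1 = μ - lam - 1 + 1 by ring,
    Complex.cpow_add _ _ (by exact_mod_cast h0.ne'), Complex.cpow_one,
    Complex.ofReal_cpow_eq_exp (radicalSubst_pos ha ht), Complex.ofReal_cpow_eq_exp (div_pos ha h0),
    Complex.ofReal_cpow_eq_exp ha2, Complex.ofReal_cpow_eq_exp ha, Complex.ofReal_cpow_eq_exp h0,
    Complex.ofReal_cpow_eq_exp h1,
    show radicalSubst a t = a / 2 * (1 - t) ^ 2 / t by unfold radicalSubst; field_simp,
    Real.log_div (by positivity) h0.ne', Real.log_mul ha2.ne' (by positivity), Real.log_pow,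
    Real.log_div ha.ne' h0.ne']
  push_cast
  have hexp : ∀ u v w p q r s y : ℂ, u + v + w = p + q + r + s →
      Complex.exp u * y * (Complex.exp v * Complex.exp w) =
        Complex.exp p * Complex.exp q * (Complex.exp r * Complex.exp s) * y := by
    intro u v w p q r s y h
    have := congrArg Complex.exp h
    simp only [Complex.exp_add] at this
    linear_combination y * this
  rw [hexp _ _ _ (Real.log (a / 2) * lam) (Real.log a * -μ) (Real.log t * (μ - lam - 1))
    (Real.log (1 - t) * (2 * lam - 1)) _ (by ring)]
  ring

lemma Complex.betaIntegral_add_betaIntegral_add_one {u v : ℂ} (hu : 0 < u.re) (hv : 0 < v.re) :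
    Complex.betaIntegral u v + Complex.betaIntegral (u + 1) v =
      Complex.Gamma v * (2 * u + v) * Complex.Gamma u / Complex.Gamma (u + v + 1) := by
  have huv : 0 < (u + v).re := by simpa using add_pos hu hv
  have hu0 : u ≠ 0 := by rintro rfl; simp at hu
  have huv0 : u + v ≠ 0 := by intro h; simp [h] at huv
  have hΓ := Complex.Gamma_ne_zero_of_re_pos huv
  rw [Complex.betaIntegral_eq_Gamma_mul_div u v hu hv,
    Complex.betaIntegral_eq_Gamma_mul_div (u + 1) v (by simp; linarith) hv,
    show u + 1 + v = u + v + 1 by ring, Complex.Gamma_add_one u hu0,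
    Complex.Gamma_add_one _ huv0]
  field_simp
  ring

lemma integrableOn_and_integral_cpow_mul_radical_cpow {a : ℝ} (ha : 0 < a) {lam μ : ℂ}
    (hlam : 0 < lam.re) (hμ : lam.re < μ.re) :
    IntegrableOn (fun x : ℝ ↦ (x : ℂ) ^ (lam - 1) *
        ((x + a + √(x ^ 2 + 2 * a * x) : ℝ) : ℂ) ^ (-μ)) (Ioi 0) ∧
      ∫ x in Ioi (0 : ℝ), (x : ℂ) ^ (lam - 1) *
          ((x + a + √(x ^ 2 + 2 * a * x) : ℝ) : ℂ) ^ (-μ) =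
        2 * ((a : ℂ) / 2) ^ lam * Complex.Gamma (2 * lam) *
          ((a : ℂ) ^ (-μ) * μ * Complex.Gamma (μ - lam) / Complex.Gamma (μ + lam + 1)) := by
  have hu : 0 < (μ - lam).re := by simpa using hμ
  have hv : 0 < (2 * lam).re := by simpa using hlam
  have hu' : 0 < (μ - lam + 1).re := by rw [Complex.add_re, Complex.one_re]; linarith
  have hd : ∀ t ∈ Ioo (0 : ℝ) 1, HasDerivWithinAt (radicalSubst a)
      (-(a / 2 * (1 - t) * (1 + t) / t ^ 2)) (Ioo 0 1) t :=
    fun t ht ↦ (hasDerivAt_radicalSubst a ht.1.ne').hasDerivWithinAt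
  have hI := Complex.betaIntegral_convergent hu hv
  have hI' := Complex.betaIntegral_convergent hu' hv
  constructor
  · rw [← image_radicalSubst ha, integrableOn_image_iff_integrableOn_abs_deriv_smul
      measurableSet_Ioo hd (injOn_radicalSubst ha),
      integrableOn_congr_fun (fun t ht ↦ radicalSubst_integrand ha ht lam μ) measurableSet_Ioo]
    have h := (hI.add hI').const_mul (((a : ℂ) / 2) ^ lam * (a : ℂ) ^ (-μ))
    rwa [intervalIntegrable_iff_integrableOn_Ioo_of_le zero_le_one] at h
  · rw [← image_radicalSubst ha, integral_image_eq_integral_abs_deriv_smul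
      measurableSet_Ioo hd (injOn_radicalSubst ha),
      setIntegral_congr_fun measurableSet_Ioo (fun t ht ↦ radicalSubst_integrand ha ht lam μ),
      ← integral_Ioc_eq_integral_Ioo, ← intervalIntegral.integral_of_le zero_le_one,
      intervalIntegral.integral_const_mul, intervalIntegral.integral_add hI hI']
    have h := Complex.betaIntegral_add_betaIntegral_add_one hu hv
    unfold Complex.betaIntegral at h
    rw [h, show μ - lam + 2 * lam + 1 = μ + lam + 1 by ring]
    ring

/-- The integral of `x^{λ-1} w(x)^{-ν} ∑_{K=0}^N c_K w(x)^{-αK}`, where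
`w(x) = x + a + √(x² + 2ax)`, equals
`2 (a/2)^λ Γ(2λ) ∑_{K=0}^N c_K a^{-ν-αK} (ν + αK) Γ(ν + αK - λ) / Γ(ν + αK + λ + 1)`. -/
theorem garg_mittal_polynomial_integral (a : ℝ) (ha : 0 < a) (lam ν : ℂ)
    (hlam : 0 < lam.re) (hlamν : lam.re < ν.re) (N : ℕ) (α : ℝ) (hα : 0 < α)
    (c : ℕ → ℂ) :
    ∫ x in Ioi (0 : ℝ), (x : ℂ) ^ (lam - 1) *
        ((x + a + Real.sqrt (x ^ 2 + 2 * a * x) : ℝ) : ℂ) ^ (-ν) *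
        ∑ K ∈ Finset.range (N + 1), c K *
          ((x + a + Real.sqrt (x ^ 2 + 2 * a * x) : ℝ) : ℂ) ^ (-((α : ℂ) * K))
      = 2 * ((a : ℂ) / 2) ^ lam * Complex.Gamma (2 * lam) *
          ∑ K ∈ Finset.range (N + 1), c K * (a : ℂ) ^ (-ν - (α : ℂ) * K) *
            (ν + (α : ℂ) * K) * Complex.Gamma (ν + (α : ℂ) * K - lam) /
            Complex.Gamma (ν + (α : ℂ) * K + lam + 1) := by
  have hre : ∀ K : ℕ, lam.re < (ν + (α : ℂ) * K).re := fun K ↦ by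
    have : 0 ≤ α * K := by positivity
    simp
    linarith
  have key := fun K : ℕ ↦ integrableOn_and_integral_cpow_mul_radical_cpow ha hlam (hre K)
  have hsum : ∀ x ∈ Ioi (0 : ℝ), (x : ℂ) ^ (lam - 1) *
        ((x + a + Real.sqrt (x ^ 2 + 2 * a * x) : ℝ) : ℂ) ^ (-ν) *
        ∑ K ∈ Finset.range (N + 1), c K *
          ((x + a + Real.sqrt (x ^ 2 + 2 * a * x) : ℝ) : ℂ) ^ (-((α : ℂ) * K)) =
      ∑ K ∈ Finset.range (N + 1), c K * ((x : ℂ) ^ (lam - 1) *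
        ((x + a + Real.sqrt (x ^ 2 + 2 * a * x) : ℝ) : ℂ) ^ (-(ν + (α : ℂ) * K))) := by
    intro x hx
    have hx : 0 < x := hx
    have hw : ((x + a + √(x ^ 2 + 2 * a * x) : ℝ) : ℂ) ≠ 0 :=
      Complex.ofReal_ne_zero.2 (by positivity)
    rw [Finset.mul_sum]
    refine Finset.sum_congr rfl fun K _ ↦ ?_
    rw [neg_add, Complex.cpow_add _ _ hw]
    ring
  rw [setIntegral_congr_fun measurableSet_Ioi hsum,
    integral_finsetSum _ fun K _ ↦ (key K).1.const_mul (c K), Finset.mul_sum]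
  refine Finset.sum_congr rfl fun K _ ↦ ?_
  rw [integral_const_mul, (key K).2, neg_add']
  ring
end
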